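/- arXiv:0806.2256 — 11 statements merged into one kernel-verified Lean document; each statement's English description precedes it below -/
import Mathlib

section
/- Let R be a meadow, i.e. a commutative ring with identity equipped with a unary operation inv : R → R satisfying reflection inv (inv x) = x and the restricted inverse law x * (x * inv x) = x for all x. Then R has no nonzero nilpotent elements of order two: for every x in R, if x * x = 0 then x = 0. -/
/-- A meadow (commutative ring with identity with `inv` satisfying
reflection and the restricted inverse law) has no nonzero nilpotent elements of
order two. -/
theorem meadow_no_nilpotents_of_order_two
    {R : Type*} [CommRing R] (inv : R → R)
    (refl : ∀ x : R, inv (inv x) = x)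
    (ril : ∀ x : R, x * (x * inv x) = x) :
    ∀ x : R, x * x = 0 → x = 0 := by
  intro x hx
  rw [← ril x, ← mul_assoc, hx, zero_mul]
end

section
/- Let R be a meadow, i.e. a commutative ring with identity equipped with a unary operation inv : R → R satisfying reflection inv (inv x) = x and the restricted inverse law x * (x * inv x) = x for all x. Then every ideal I of R (as a commutative ring) is closed under the inverse operation: for every x, if x ∈ I then inv x ∈ I. (This follows since inv x = inv x * inv x * x.) -/
/-- In a meadow, every ideal (of the underlying commutative ring)
is closed under the inverse operation. -/
theorem meadow_ideal_closed_under_inv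
    {R : Type*} [CommRing R] (inv : R → R)
    (refl : ∀ x : R, inv (inv x) = x)
    (ril : ∀ x : R, x * (x * inv x) = x)
    (I : Ideal R) :
    ∀ x : R, x ∈ I → inv x ∈ I := by
  intro x hx
  have h := ril (inv x)
  rw [refl] at h
  rw [← h]
  exact I.mul_mem_left _ (I.mul_mem_left _ hx)
end

section
/- Let P = ∏_{p prime} 𝔽_p be the direct product over all prime numbers p of the prime fields 𝔽_p = ZMod p, equipped with the pointwise inverse operation (where in each field 𝔽_p the inverse of 0 is 0), and let A be the smallest subring of P that is closed under this inverse operation. For a prime p, let Z_p ∈ P be the element whose coordinate at p is 1 and whose coordinate at every other prime q is 0. Then Z_p equals the element 1 - (p : P) * inv (p : P) of P (where (p : P) is the image of the natural number p under the canonical map ℕ → P), and consequently Z_p ∈ A. -/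
/-- The index type of all prime numbers. -/
abbrev Primes : Type := {p : ℕ // Nat.Prime p}

/-- `P` is the direct product over all primes `p` of the prime fields `ZMod p`. -/
abbrev P : Type := ∀ p : Primes, ZMod p.1

/-- The pointwise (zero-totalized) inverse operation on `P`: in each coordinate we
take the zero-totalized field inverse of `ZMod p` (which satisfies `0⁻¹ = 0`). -/
def pinv (x : P) : P := fun p => (x p)⁻¹

/-- `A` is the smallest subring of `P` that is closed under the inverse operation. -/
def A : Subring P := sInf {S : Subring P | ∀ x ∈ S, pinv x ∈ S}

/-- `Zp p` is the element of `P` that is `1` at coordinate `p` and `0` elsewhere. -/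
def Zp (p : Primes) : P := fun q => if q = p then 1 else 0

theorem Zp_eq_one_sub_mul_pinv (p : Primes) : Zp p = 1 - (p.1 : P) * pinv (p.1 : P) := by
  funext q
  have : Fact q.1.Prime := ⟨q.2⟩
  change (if q = p then 1 else 0) = 1 - ((p.1 : ℕ) : ZMod q.1) * ((p.1 : ℕ) : ZMod q.1)⁻¹
  split_ifs with h
  · subst h
    simp
  · have hne : ((p.1 : ℕ) : ZMod q.1) ≠ 0 := by
      rw [Ne, ZMod.natCast_eq_zero_iff, Nat.prime_dvd_prime_iff_eq q.2 p.2]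
      exact fun e => h (Subtype.ext e)
    rw [mul_inv_cancel₀ hne, sub_self]

theorem pinv_mem_A {x : P} (hx : x ∈ A) : pinv x ∈ A :=
  Subring.mem_sInf.2 fun S hS => hS x (Subring.mem_sInf.1 hx S hS)

/-- `Zp p = 1 - p * (p)⁻¹` in `P`, and consequently `Zp p ∈ A`. -/
theorem Zp_eq_and_mem (p : Primes) :
    Zp p = 1 - (p.1 : P) * pinv (p.1 : P) ∧ Zp p ∈ A := by
  refine ⟨Zp_eq_one_sub_mul_pinv p, ?_⟩
  rw [Zp_eq_one_sub_mul_pinv]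
  have hp : (p.1 : P) ∈ A := natCast_mem A p.1
  exact sub_mem (one_mem A) (mul_mem hp (pinv_mem_A hp))
end

section
/- Let M be a meadow, i.e. a commutative ring with identity equipped with a unary operation inv satisfying inv (inv x) = x and x * (x * inv x) = x for all x. For a prime number p, define Z_p = 1 - (p : M) * inv (p : M), where (p : M) is the image of p under the canonical map ℕ → M. Then Z_p * Z_p = Z_p and inv Z_p = Z_p. -/
/-- In a meadow, every idempotent is its own inverse. -/
theorem meadow_inv_eq_self_of_isIdempotentElem
    {M : Type*} [CommRing M] (inv : M → M)
    (refl : ∀ x : M, inv (inv x) = x)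
    (ril : ∀ x : M, x * (x * inv x) = x)
    {e : M} (he : IsIdempotentElem e) : inv e = e := by
  have h_mul : e * inv e = e := by
    have h := ril e
    rwa [← mul_assoc, he.eq] at h
  have h := ril (inv e)
  rw [refl, mul_comm (inv e) e, h_mul, mul_comm, h_mul] at h
  exact h.symm

/-- in a meadow `M`, for a prime `p`, the element
`Z_p = 1 - p * inv p` is idempotent and is its own inverse. -/
theorem Zp_idempotent_and_inv
    {M : Type*} [CommRing M] (inv : M → M)
    (refl : ∀ x : M, inv (inv x) = x)
    (ril : ∀ x : M, x * (x * inv x) = x)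
    (p : ℕ) (hp : Nat.Prime p) :
    (1 - (p : M) * inv (p : M)) * (1 - (p : M) * inv (p : M))
        = 1 - (p : M) * inv (p : M) ∧
    inv (1 - (p : M) * inv (p : M)) = 1 - (p : M) * inv (p : M) := by
  have h_idem : IsIdempotentElem ((p : M) * inv (p : M)) := by
    have h := ril (p : M)
    unfold IsIdempotentElem
    linear_combination inv (p : M) * h
  exact ⟨h_idem.one_sub.eq,
    meadow_inv_eq_self_of_isIdempotentElem inv refl ril h_idem.one_sub⟩
end

section
/- Let M be a meadow, i.e. a commutative ring with identity equipped with a unary operation inv satisfying inv (inv x) = x and x * (x * inv x) = x for all x. For a prime number p, define Z_p = 1 - (p : M) * inv (p : M). Then for any two distinct prime numbers p and q, Z_p * Z_q = 0. -/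
/-- in a meadow `M`, for distinct primes `p` and `q`, the elements
`Z_p = 1 - p * inv p` and `Z_q = 1 - q * inv q` multiply to `0`. -/
theorem Zp_mul_Zq_eq_zero
    {M : Type*} [CommRing M] (inv : M → M)
    (refl : ∀ x : M, inv (inv x) = x)
    (ril : ∀ x : M, x * (x * inv x) = x)
    (p q : ℕ) (hp : Nat.Prime p) (hq : Nat.Prime q) (hpq : p ≠ q) :
    (1 - (p : M) * inv (p : M)) * (1 - (q : M) * inv (q : M)) = 0 := by
  obtain ⟨a, b, hab⟩ := Nat.isCoprime_iff_coprime.mpr ((Nat.coprime_primes hp hq).mpr hpq)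
  have bezout : (a : M) * p + b * q = 1 := by exact_mod_cast congrArg (Int.cast : ℤ → M) hab
  linear_combination
    -(1 - (p : M) * inv p) * (1 - (q : M) * inv q) * bezout
      - a * (1 - (q : M) * inv q) * ril p - b * (1 - (p : M) * inv p) * ril q
end

section
/- Let M be a meadow, i.e. a commutative ring with identity equipped with a unary operation inv satisfying inv (inv x) = x and x * (x * inv x) = x for all x. For a prime number p, define Z_p = 1 - (p : M) * inv (p : M). Then for every natural number m, Z_p * (m : M) = Z_p * ((m % p) : M), where m % p is the remainder of m modulo p. -/
/-- in a meadow `M`, for a prime `p` and `Z_p = 1 - p * inv p`,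
multiplication by `Z_p` reduces natural numbers modulo `p`:
`Z_p * m = Z_p * (m % p)` for every natural number `m`. -/
theorem Zp_mul_natCast_mod
    {M : Type*} [CommRing M] (inv : M → M)
    (refl : ∀ x : M, inv (inv x) = x)
    (ril : ∀ x : M, x * (x * inv x) = x)
    (p : ℕ) (hp : Nat.Prime p) (m : ℕ) :
    (1 - (p : M) * inv (p : M)) * (m : M)
      = (1 - (p : M) * inv (p : M)) * ((m % p : ℕ) : M) := by
  have hm : (m : M) = ((m % p : ℕ) : M) + (p : M) * ((m / p : ℕ) : M) := by
    exact_mod_cast congrArg (Nat.cast : ℕ → M) (Nat.mod_add_div m p).symm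
  rw [hm]
  linear_combination (-((m / p : ℕ) : M)) * ril (p : M)
end

section
/- Let M be a meadow, i.e. a commutative ring with identity equipped with a unary operation inv satisfying inv (inv x) = x and x * (x * inv x) = x for all x. For a prime number p, define Z_p = 1 - (p : M) * inv (p : M). Then for every natural number m: (a) if p divides m, then Z_p * inv (m : M) = 0; and (b) if p does not divide m and l is a natural number with 0 < l < p and l * m ≡ 1 (mod p), then Z_p * inv (m : M) = Z_p * (l : M). -/
/-- in a meadow `M`, for a prime `p` and `Z_p = 1 - p * inv p`:
(a) if `p ∣ m` then `Z_p * inv m = 0`; (b) if `p ∤ m` and `0 < l < p` with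
`l * m ≡ 1 [MOD p]`, then `Z_p * inv m = Z_p * l`. -/
theorem Zp_mul_inv_natCast
    {M : Type*} [CommRing M] (inv : M → M)
    (refl : ∀ x : M, inv (inv x) = x)
    (ril : ∀ x : M, x * (x * inv x) = x)
    (p : ℕ) (hp : Nat.Prime p) (m : ℕ) :
    (p ∣ m → (1 - (p : M) * inv (p : M)) * inv (m : M) = 0) ∧
    (¬ p ∣ m → ∀ l : ℕ, 0 < l → l < p → l * m ≡ 1 [MOD p] →
      (1 - (p : M) * inv (p : M)) * inv (m : M)
        = (1 - (p : M) * inv (p : M)) * (l : M)) := by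
  have hZ : (1 - (p : M) * inv (p : M)) * (p : M) = 0 := by
    linear_combination -ril (p : M)
  have inv_ril : inv (m : M) * (inv (m : M) * (m : M)) = inv (m : M) := by
    simpa only [refl] using ril (inv (m : M))
  have hm := ril (m : M)
  generalize (1 - (p : M) * inv (p : M)) = Z at *
  generalize inv (m : M) = y at *
  refine ⟨?_, ?_⟩
  · rintro ⟨k, rfl⟩
    push_cast at inv_ril
    linear_combination (-Z) * inv_ril + (k : M) * y ^ 2 * hZ
  · intro _ l _ _ hl
    obtain ⟨k, hk⟩ := Nat.modEq_iff_dvd.mp hl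
    have hk' : (1 : M) - l * m = p * k := by
      exact_mod_cast congrArg (Int.cast : ℤ → M) hk
    have hlm : Z * (l * m) = Z := by
      linear_combination (-Z) * hk' - (k : M) * hZ
    linear_combination (l - l * m * y - y) * hlm + Z * l ^ 2 * hm
end

section
/- Let MTerm be the inductive type of closed meadow terms, with constructors for 0, 1, negation, inverse, addition, and multiplication, and for a meadow M let eval_M : MTerm → M be the evaluation map. Let (p_n) enumerate the primes in increasing order with p_0 = 2, and let φ_n(t) ∈ ZMod p_n be the evaluation of t in ZMod p_n equipped with its zero-totalized field inverse (0⁻¹ = 0). Then for every meadow M, every n ∈ ℕ, and every t ∈ MTerm: eval_M(Z_n) * eval_M(t) = eval_M(Z_n) * ((φ_n(t)).val : M), where Z_n denotes the closed term 1 - p̲_n · (p̲_n)⁻¹ (with p̲_n the numeral term for p_n), and (φ_n(t)).val ∈ ℕ is the canonical natural number representative of φ_n(t). -/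
/-- Closed meadow terms: `0`, `1`, negation, inverse, addition, multiplication. -/
inductive MTerm : Type
  | zero : MTerm
  | one : MTerm
  | neg : MTerm → MTerm
  | inv : MTerm → MTerm
  | add : MTerm → MTerm → MTerm
  | mul : MTerm → MTerm → MTerm

/-- Evaluation of a closed meadow term in a commutative ring `M` equipped with a
unary operation `invM` (interpreting the inverse constructor). -/
def MTerm.eval {M : Type*} [CommRing M] (invM : M → M) : MTerm → M
  | .zero => 0
  | .one => 1
  | .neg t => -(t.eval invM)
  | .inv t => invM (t.eval invM)
  | .add s t => s.eval invM + t.eval invM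
  | .mul s t => s.eval invM * t.eval invM

/-- The numeral term `k̲`, the `k`-fold sum of the term `1`. -/
def numeral : ℕ → MTerm
  | 0 => .zero
  | k + 1 => .add (numeral k) .one

/-- `nthPrime n` is the `n`-th prime, with `nthPrime 0 = 2`. -/
noncomputable def nthPrime (n : ℕ) : ℕ := Nat.nth Nat.Prime n

/-- `φₙ t` is the evaluation of `t` in `ZMod (nthPrime n)` with its zero-totalized
field inverse. -/
noncomputable def phiN (n : ℕ) (t : MTerm) : ZMod (nthPrime n) :=
  t.eval (fun x : ZMod (nthPrime n) => x⁻¹)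

/-- The closed term `Z_n = 1 - p̲ₙ · (p̲ₙ)⁻¹`. -/
noncomputable def Zterm (n : ℕ) : MTerm :=
  .add .one (.neg (.mul (numeral (nthPrime n)) (.inv (numeral (nthPrime n)))))

theorem eval_numeral {M : Type*} [CommRing M] (invM : M → M) (k : ℕ) :
    (numeral k).eval invM = (k : M) := by
  induction k with
  | zero => simp [numeral, MTerm.eval]
  | succ k ih => simp [numeral, MTerm.eval, ih]

/-- If `z` is annihilated by `p`, then `z * k` depends only on `k` modulo `p`. -/
theorem mul_natCast_eq_of_zmod_eq {M : Type*} [CommRing M] {p : ℕ} {z : M}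
    (hz : z * (p : M) = 0) {a b : ℕ} (h : (a : ZMod p) = b) : z * (a : M) = z * (b : M) := by
  obtain ⟨c, hc⟩ := (ZMod.intCast_eq_intCast_iff_dvd_sub (a : ℤ) b p).1 (by exact_mod_cast h)
  have hc' : (b : M) - a = p * c := by exact_mod_cast congrArg (Int.cast : ℤ → M) hc
  linear_combination -z * hc' - c * hz

/-- If `p` is a prime annihilating `z`, then evaluating a closed term in a meadow and in `ZMod p`
agree after multiplication by `z`. -/
theorem mul_eval_eq_mul_val {M : Type*} [CommRing M] (invM : M → M)
    (refl : ∀ x : M, invM (invM x) = x) (ril : ∀ x : M, x * (x * invM x) = x)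
    (p : ℕ) [Fact p.Prime] {z : M} (hz : z * (p : M) = 0) (t : MTerm) :
    z * t.eval invM = z * (((t.eval (fun x : ZMod p => x⁻¹)).val : ℕ) : M) := by
  induction t with
  | zero => simp [MTerm.eval]
  | one =>
    have h := mul_natCast_eq_of_zmod_eq (a := 1) (b := (1 : ZMod p).val) hz (by simp)
    simpa [MTerm.eval] using h
  | neg t ih =>
    simp only [MTerm.eval]
    generalize t.eval (fun x : ZMod p => x⁻¹) = k at *
    have h := mul_natCast_eq_of_zmod_eq (a := (-k).val + k.val) (b := 0) hz (by simp)
    push_cast at h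
    linear_combination -ih - h
  | add s t ihs iht =>
    simp only [MTerm.eval]
    generalize s.eval (fun x : ZMod p => x⁻¹) = j at *
    generalize t.eval (fun x : ZMod p => x⁻¹) = k at *
    have h := mul_natCast_eq_of_zmod_eq (a := (j + k).val) (b := j.val + k.val) hz (by simp)
    push_cast at h
    linear_combination ihs + iht - h
  | mul s t ihs iht =>
    simp only [MTerm.eval]
    generalize s.eval (fun x : ZMod p => x⁻¹) = j at *
    generalize t.eval (fun x : ZMod p => x⁻¹) = k at *
    have h := mul_natCast_eq_of_zmod_eq (a := (j * k).val) (b := j.val * k.val) hz (by simp)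
    push_cast at h
    linear_combination t.eval invM * ihs + (j.val : M) * iht - h
  | inv t ih =>
    simp only [MTerm.eval]
    generalize t.eval (fun x : ZMod p => x⁻¹) = k at *
    generalize t.eval invM = x at *
    have hx := ril x
    have hy := ril (invM x)
    rw [refl] at hy
    generalize invM x = y at *
    by_cases hk : k = 0
    · subst hk
      simp only [ZMod.val_zero, Nat.cast_zero, mul_zero, inv_zero] at ih ⊢
      linear_combination -z * hy + y * y * ih
    · have h := mul_natCast_eq_of_zmod_eq (a := k.val * k⁻¹.val) (b := 1) hz (by simp [hk])
      push_cast at h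
      have hxk : z * x * (k⁻¹.val : M) = z := by linear_combination (k⁻¹.val : M) * ih + h
      have hxy : z * x * y = z := by
        linear_combination (k⁻¹.val : M) * z * hx + (1 - x * y) * hxk
      linear_combination -y * hxk + (k⁻¹.val : M) * hxy

/-- in every meadow `M`, for every `n` and closed term `t`,
`eval_M(Z_n) * eval_M(t) = eval_M(Z_n) * (φₙ(t)).val`. -/
theorem Zterm_mul_eval
    (M : Type*) [CommRing M] (invM : M → M)
    (refl : ∀ x : M, invM (invM x) = x)
    (ril : ∀ x : M, x * (x * invM x) = x)
    (n : ℕ) (t : MTerm) :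
    (Zterm n).eval invM * t.eval invM
      = (Zterm n).eval invM * (((phiN n t).val : ℕ) : M) := by
  have : Fact (nthPrime n).Prime := ⟨Nat.prime_nth_prime n⟩
  refine mul_eval_eq_mul_val invM refl ril (nthPrime n) ?_ t
  simp only [Zterm, MTerm.eval, eval_numeral]
  linear_combination -ril (nthPrime n : M)
end

section
/- Let M be a meadow, i.e. a commutative ring with identity equipped with a unary operation inv satisfying inv (inv x) = x and x * (x * inv x) = x for all x. Let (p_n) enumerate the primes in increasing order with p_0 = 2, and for i, n ∈ ℕ define Z_i = 1 - (p_i : M) * inv (p_i : M) and G_n = ∏_{i < n} (1 - Z_i). Then for every n: G_n = 1 - Z_0 - Z_1 - ⋯ - Z_{n-1} (i.e. G_n = 1 - ∑_{i<n} Z_i), and G_n * Z_n = Z_n. -/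
/-- In a commutative ring `M` with a unary operation `invM`,
`Zel invM i = 1 - pᵢ * invM pᵢ` where `pᵢ` is the `i`-th prime (`p₀ = 2`). -/
noncomputable def Zel {M : Type*} [CommRing M] (invM : M → M) (i : ℕ) : M :=
  1 - ((Nat.nth Nat.Prime i : ℕ) : M) * invM ((Nat.nth Nat.Prime i : ℕ) : M)

/-- `Gel invM` is defined inductively: `G₀ = 1`, `G_{n+1} = G_n * (1 - Z_n)`. -/
noncomputable def Gel {M : Type*} [CommRing M] (invM : M → M) : ℕ → M
  | 0 => 1
  | n + 1 => Gel invM n * (1 - Zel invM n)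

theorem natCast_nth_prime_mul_Zel {M : Type*} [CommRing M] {invM : M → M}
    (ril : ∀ x : M, x * (x * invM x) = x) (i : ℕ) :
    ((Nat.nth Nat.Prime i : ℕ) : M) * Zel invM i = 0 := by
  rw [Zel, mul_sub, mul_one, ril, sub_self]

theorem Zel_mul_Zel_of_ne {M : Type*} [CommRing M] {invM : M → M}
    (ril : ∀ x : M, x * (x * invM x) = x) {i j : ℕ} (hij : i ≠ j) :
    Zel invM i * Zel invM j = 0 := by
  have hcop : Nat.Coprime (Nat.nth Nat.Prime i) (Nat.nth Nat.Prime j) :=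
    (Nat.coprime_primes (Nat.prime_nth_prime i) (Nat.prime_nth_prime j)).2
      fun h => hij (Nat.nth_injective Nat.infinite_setOfPred_prime h)
  obtain ⟨a, b, hab⟩ := hcop.cast (R := M)
  linear_combination (-(Zel invM i * Zel invM j)) * hab
    + a * Zel invM j * natCast_nth_prime_mul_Zel ril i
    + b * Zel invM i * natCast_nth_prime_mul_Zel ril j

theorem Gel_mul_Zel_of_le {M : Type*} [CommRing M] {invM : M → M}
    (ril : ∀ x : M, x * (x * invM x) = x) {n m : ℕ} (h : n ≤ m) :
    Gel invM n * Zel invM m = Zel invM m := by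
  induction n with
  | zero => rw [Gel, one_mul]
  | succ n ih =>
    rw [Gel]
    linear_combination ih (by omega) - Gel invM n * Zel_mul_Zel_of_ne ril (by omega : n ≠ m)

/-- in a meadow `M`, `G_n = 1 - ∑_{i<n} Z_i` and `G_n * Z_n = Z_n`. -/
theorem Gel_eq_one_sub_sum_and_mul_Zel
    {M : Type*} [CommRing M] (invM : M → M)
    (refl : ∀ x : M, invM (invM x) = x)
    (ril : ∀ x : M, x * (x * invM x) = x)
    (n : ℕ) :
    Gel invM n = 1 - ∑ i ∈ Finset.range n, Zel invM i ∧
    Gel invM n * Zel invM n = Zel invM n := by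
  refine ⟨?_, Gel_mul_Zel_of_le ril le_rfl⟩
  induction n with
  | zero => simp [Gel]
  | succ n ih =>
    rw [Gel, Finset.sum_range_succ, mul_sub, mul_one, Gel_mul_Zel_of_le ril le_rfl, ih, sub_sub]
end

section
/- Let M be a meadow, i.e. a commutative ring with identity equipped with a unary operation inv satisfying inv (inv x) = x and x * (x * inv x) = x for all x. Let (p_n) enumerate the primes in increasing order with p_0 = 2, and for i, n ∈ ℕ define Z_i = 1 - (p_i : M) * inv (p_i : M) and G_n inductively by G_0 = 1, G_{n+1} = G_n * (1 - Z_n). Then for all n, m ∈ ℕ: inv G_n = G_n, and if n ≤ m then G_m = G_m * G_n. -/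
theorem inv_eq_self_of_isIdempotentElem {M : Type*} [CommRing M] {invM : M → M}
    (refl : ∀ x : M, invM (invM x) = x)
    (ril : ∀ x : M, x * (x * invM x) = x)
    {e : M} (he : IsIdempotentElem e) : invM e = e := by
  have hmul : e * invM e = e := by
    simpa only [← mul_assoc, he.eq] using ril e
  have hinv := ril (invM e)
  rw [refl, mul_comm (invM e) e, hmul, mul_comm, hmul] at hinv
  exact hinv.symm

theorem isIdempotentElem_one_sub_Zel {M : Type*} [CommRing M] {invM : M → M}
    (ril : ∀ x : M, x * (x * invM x) = x) (i : ℕ) :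
    IsIdempotentElem (1 - Zel invM i) := by
  have h := ril ((Nat.nth Nat.Prime i : ℕ) : M)
  simp only [IsIdempotentElem, Zel, sub_sub_cancel]
  linear_combination invM ((Nat.nth Nat.Prime i : ℕ) : M) * h

theorem isIdempotentElem_Gel {M : Type*} [CommRing M] {invM : M → M}
    (ril : ∀ x : M, x * (x * invM x) = x) (n : ℕ) :
    IsIdempotentElem (Gel invM n) := by
  induction n with
  | zero => exact IsIdempotentElem.one
  | succ n ih => exact ih.mul (isIdempotentElem_one_sub_Zel ril n)

theorem Gel_dvd_Gel {M : Type*} [CommRing M] (invM : M → M) {n m : ℕ} (hnm : n ≤ m) :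
    Gel invM n ∣ Gel invM m := by
  induction hnm with
  | refl => exact dvd_rfl
  | step _ ih => exact ih.mul_right _

/-- in a meadow `M`, `inv G_n = G_n`, and if `n ≤ m` then
`G_m = G_m * G_n`. -/
theorem Gel_inv_and_absorb
    {M : Type*} [CommRing M] (invM : M → M)
    (refl : ∀ x : M, invM (invM x) = x)
    (ril : ∀ x : M, x * (x * invM x) = x)
    (n m : ℕ) :
    invM (Gel invM n) = Gel invM n ∧
    (n ≤ m → Gel invM m = Gel invM m * Gel invM n) := by
  have hG := isIdempotentElem_Gel ril n
  refine ⟨inv_eq_self_of_isIdempotentElem refl ril hG, fun hnm => ?_⟩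
  obtain ⟨c, hc⟩ := Gel_dvd_Gel invM hnm
  rw [hc, mul_right_comm, hG.eq]
end

section
/- Let M be a meadow, i.e. a commutative ring with identity equipped with a unary operation inv satisfying inv (inv x) = x and x * (x * inv x) = x for all x. Let (p_n) enumerate the primes in increasing order with p_0 = 2, and for i, n ∈ ℕ define Z_i = 1 - (p_i : M) * inv (p_i : M) and G_n inductively by G_0 = 1, G_{n+1} = G_n * (1 - Z_n). Then for every n ∈ ℕ and every natural number k with 0 < k < p_n: G_n * (k : M) * inv (k : M) = G_n. -/
/-- Under the restricted inverse law, `g * x * invM x = g` as soon as `g * x` divides `g`. -/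
theorem mul_mul_inv_eq_of_mul_dvd {M : Type*} [CommRing M] {invM : M → M}
    (ril : ∀ x : M, x * (x * invM x) = x) {g x : M} (h : g * x ∣ g) :
    g * x * invM x = g := by
  obtain ⟨y, hy⟩ := h
  linear_combination (x * invM x - 1) * hy + g * y * ril x

theorem Gel_mul_prime_dvd {M : Type*} [CommRing M] {invM : M → M}
    (ril : ∀ x : M, x * (x * invM x) = x) {i n : ℕ} (hi : i < n) :
    Gel invM n * ((Nat.nth Nat.Prime i : ℕ) : M) ∣ Gel invM n := by
  induction n with
  | zero => omega
  | succ n ih =>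
    rcases Nat.lt_succ_iff_lt_or_eq.mp hi with h | rfl
    · rw [Gel, mul_right_comm]
      exact mul_dvd_mul_right (ih h) _
    · refine ⟨invM ((Nat.nth Nat.Prime i : ℕ) : M), ?_⟩
      simp only [Gel, Zel]
      linear_combination
        -(Gel invM i * invM ((Nat.nth Nat.Prime i : ℕ) : M)) *
          ril ((Nat.nth Nat.Prime i : ℕ) : M)

theorem Gel_mul_cast_dvd {M : Type*} [CommRing M] {invM : M → M}
    (ril : ∀ x : M, x * (x * invM x) = x) {n k : ℕ} (hk0 : 0 < k)
    (hk : k < Nat.nth Nat.Prime n) : Gel invM n * (k : M) ∣ Gel invM n := by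
  induction k using Nat.recOnMul with
  | zero => omega
  | one => simp
  | prime p hp =>
    rw [← Nat.nth_count hp] at hk ⊢
    exact Gel_mul_prime_dvd ril ((Nat.nth_lt_nth Nat.infinite_setOfPred_prime).mp hk)
  | mul a b iha ihb =>
    have ha : 0 < a := Nat.pos_of_mul_pos_right hk0
    have hb : 0 < b := Nat.pos_of_mul_pos_left hk0
    rw [Nat.cast_mul, ← mul_assoc]
    exact (mul_dvd_mul_right (iha ha ((Nat.le_mul_of_pos_right a hb).trans_lt hk)) _).trans
      (ihb hb ((Nat.le_mul_of_pos_left b ha).trans_lt hk))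

/-- in a meadow `M`, if `0 < k < pₙ` then
`G_n * k * invM k = G_n`. -/
theorem Gel_mul_cast_mul_inv_cast
    {M : Type*} [CommRing M] (invM : M → M)
    (refl : ∀ x : M, invM (invM x) = x)
    (ril : ∀ x : M, x * (x * invM x) = x)
    (n k : ℕ) (hk0 : 0 < k) (hk : k < Nat.nth Nat.Prime n) :
    Gel invM n * (k : M) * invM (k : M) = Gel invM n := by
  exact mul_mul_inv_eq_of_mul_dvd ril (Gel_mul_cast_dvd ril hk0 hk)
end
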